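/- For every primitive vector v ∈ ℤ³, there exists a homeomorphism h : (ℝ/ℤ)² × (ℝ/ℤ) → (ℝ/ℤ)³ which is simultaneously an isomorphism of additive groups, such that χ_v ∘ h is the projection onto the second factor. (This is the content of Lemma 2.3: every essential 2-torus in the 3-torus is the fiber of a trivial fiber bundle T³ → S¹.) -/

import Mathlib

noncomputable section

abbrev S1 : Type := AddCircle (1 : ℝ)
abbrev T3 : Type := Fin 3 → S1

/-- The character of `T³` associated to an integer vector `v`. -/
def chi (v : Fin 3 → ℤ) : T3 →+ S1 where
  toFun x := ∑ i, v i • x i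
  map_zero' := by simp
  map_add' x y := by
    simp [smul_add, Finset.sum_add_distrib]

/-- A vector of `ℤ³` is primitive if the gcd of its entries is `1`. -/
def Primitive (v : Fin 3 → ℤ) : Prop :=
  Int.gcd (v 0) (Int.gcd (v 1) (v 2)) = 1

/-- A vector `(a, b, c)` with `gcd (a, b, c) = 1` factors through two Bézout relations. -/
lemma Primitive.exists_bezout {v : Fin 3 → ℤ} (hv : Primitive v) :
    ∃ g b c s t x y : ℤ, v 1 = g * b ∧ v 2 = g * c ∧ b * s + c * t = 1 ∧ v 0 * x + g * y = 1 := by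
  have hxy : v 0 * Int.gcdA (v 0) (Int.gcd (v 1) (v 2)) +
      (Int.gcd (v 1) (v 2) : ℤ) * Int.gcdB (v 0) (Int.gcd (v 1) (v 2)) = 1 := by
    rw [← Int.gcd_eq_gcd_ab]
    exact_mod_cast hv
  rcases Nat.eq_zero_or_pos (Int.gcd (v 1) (v 2)) with hg | hg
  · obtain ⟨h₁, h₂⟩ := Int.gcd_eq_zero_iff.mp hg
    exact ⟨_, 1, 0, 1, 0, _, _, by simp [h₁, h₂], by simp [h₂], by simp, hxy⟩
  · obtain ⟨b, hb⟩ := Int.gcd_dvd_left (v 1) (v 2)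
    obtain ⟨c, hc⟩ := Int.gcd_dvd_right (v 1) (v 2)
    refine ⟨_, b, c, Int.gcdA (v 1) (v 2), Int.gcdB (v 1) (v 2), _, _, hb, hc, ?_, hxy⟩
    have hg' : (Int.gcd (v 1) (v 2) : ℤ) ≠ 0 := by exact_mod_cast hg.ne'
    apply mul_left_cancel₀ hg'
    linear_combination -(Int.gcd_eq_gcd_ab (v 1) (v 2)) - Int.gcdA (v 1) (v 2) * hb
      - Int.gcdB (v 1) (v 2) * hc

/-- The automorphism of tori given by the unimodular matrix built from two Bézout relations. -/
def bezoutHomeomorph (a g b c s t x y : ℤ) (hst : b * s + c * t = 1) (hxy : a * x + g * y = 1) :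
    (S1 × S1) × S1 ≃ₜ T3 where
  toFun p := ![x • p.2 - g • p.1.1, s • (y • p.2 + a • p.1.1) - c • p.1.2,
    t • (y • p.2 + a • p.1.1) + b • p.1.2]
  invFun z := ((x • (b • z 1 + c • z 2) - y • z 0, s • z 2 - t • z 1),
    a • z 0 + g • (b • z 1 + c • z 2))
  left_inv := by
    rintro ⟨⟨p, q⟩, r⟩
    simp only [Matrix.cons_val_zero, Matrix.cons_val_one, Matrix.cons_val, Prod.mk.injEq]
    refine ⟨⟨?_, ?_⟩, ?_⟩
    · linear_combination (norm := module) (x * hst) • (y • r + a • p) + hxy • p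
    · linear_combination (norm := module) hst • q
    · linear_combination (norm := module) (g * hst) • (y • r + a • p) + hxy • r
  right_inv := by
    intro z
    ext i
    fin_cases i
    · simp only [Fin.zero_eta, Matrix.cons_val_zero]
      linear_combination (norm := module) hxy • z 0
    · simp only [Fin.mk_one, Matrix.cons_val_one, Matrix.cons_val_zero]
      linear_combination (norm := module) (s * hxy) • (b • z 1 + c • z 2) + hst • z 1
    · simp only [Fin.reduceFinMk, Matrix.cons_val]
      linear_combination (norm := module) (t * hxy) • (b • z 1 + c • z 2) + hst • z 2
  continuous_toFun := by
    refine continuous_pi fun i => ?_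
    fin_cases i <;> simp <;> fun_prop
  continuous_invFun := by fun_prop

/-- Every essential 2-torus in the 3-torus is the fiber of a trivial fibration
`T³ → S¹`: for every primitive `v ∈ ℤ³` there is a homeomorphism
`(ℝ/ℤ)² × (ℝ/ℤ) ≃ (ℝ/ℤ)³` which is also an additive group isomorphism and which
carries `χ_v` to the projection onto the second factor. -/
theorem exists_trivialization_of_primitive (v : Fin 3 → ℤ) (hv : Primitive v) :
    ∃ h : (S1 × S1) × S1 ≃ₜ T3,
      (∀ a b : (S1 × S1) × S1, h (a + b) = h a + h b) ∧
      (∀ p : (S1 × S1) × S1, chi v (h p) = p.2) := by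
  obtain ⟨g, b, c, s, t, x, y, h₁, h₂, hst, hxy⟩ := hv.exists_bezout
  refine ⟨bezoutHomeomorph (v 0) g b c s t x y hst hxy, fun p q => ?_, fun p => ?_⟩
  · ext i
    fin_cases i <;> simp [bezoutHomeomorph] <;> module
  · suffices v 0 • (x • p.2 - g • p.1.1) + (g * b) • (s • (y • p.2 + v 0 • p.1.1) - c • p.1.2) +
        (g * c) • (t • (y • p.2 + v 0 • p.1.1) + b • p.1.2) = p.2 by
      simpa [chi, bezoutHomeomorph, Fin.sum_univ_three, h₁, h₂] using this
    linear_combination (norm := module) (g * hst) • (y • p.2 + v 0 • p.1.1) + hxy • p.2
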